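/- arXiv:1210.4823 — 5 statements merged into one kernel-verified Lean document; each statement's English description precedes it below -/
import Mathlib

section
/- Fix R > 0 and an integer k ≥ 1. Define the perfect plasmon wave ψ̂_k : ℝ² → ℝ in polar coordinates x = r(cos θ, sin θ) by ψ̂_k(x) = r^k cos(kθ) for |x| < R and ψ̂_k(x) = r^{−k} R^{2k} cos(kθ) for |x| ≥ R, and define A₀ : ℝ² → ℝ by A₀ = −1 on B_R(0) and A₀ = +1 outside B_R(0). Then ψ̂_k is continuous on ℝ², its gradient is square integrable on ℝ², and ψ̂_k is a weak solution of ∇·(A₀∇ψ̂_k) = 0, i.e. ∫_{ℝ²} A₀ ∇ψ̂_k · ∇φ dx = 0 for every smooth compactly supported φ : ℝ² → ℝ. -/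
open MeasureTheory Real Filter

noncomputable section

open scoped Classical

def grad1R (v : ℂ → ℝ) (z : ℂ) : ℝ := fderiv ℝ v z 1

def grad2R (v : ℂ → ℝ) (z : ℂ) : ℝ := fderiv ℝ v z Complex.I

def gradDotR (v φ : ℂ → ℝ) (z : ℂ) : ℝ :=
  grad1R v z * grad1R φ z + grad2R v z * grad2R φ z

def gradSqR (v : ℂ → ℝ) (z : ℂ) : ℝ := grad1R v z ^ 2 + grad2R v z ^ 2

/-- The perfect plasmon wave `ψ̂_k` for the circle of radius `R`:
`r^k cos(kθ) = Re(z^k)` for `|z| < R` and `r^{-k} R^{2k} cos(kθ) = R^{2k} Re(z^{-k})`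
for `|z| ≥ R`. -/
def plasmonWave (R : ℝ) (k : ℕ) (z : ℂ) : ℝ :=
  if ‖z‖ < R then (z ^ k).re else R ^ (2 * k) * (z ^ (-(k:ℤ))).re

/-- The coreless coefficient `A₀`: `-1` on `B_R(0)`, `+1` outside. -/
def corelessA (R : ℝ) (z : ℂ) : ℝ := if ‖z‖ ≤ R then -1 else 1

/-- The identity inside the circle of radius `R`, inversion in that circle outside. -/
def circleFold (R : ℝ) (z : ℂ) : ℂ :=
  if ‖z‖ < R then z else (R : ℂ) ^ 2 / (starRingEnd ℂ) z

lemma circleFold_eq_smul {R : ℝ} {z : ℂ} (hz : R ≤ ‖z‖) :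
    circleFold R z = ((R ^ 2 / ‖z‖ ^ 2 : ℝ) : ℂ) * z := by
  rw [circleFold, if_neg hz.not_gt]
  rcases eq_or_ne z 0 with rfl | h
  · simp
  have h' : (starRingEnd ℂ) z ≠ 0 := by simpa using h
  push_cast
  rw [← Complex.mul_conj']
  field_simp

lemma norm_circleFold_le {R : ℝ} (hR : 0 ≤ R) (z : ℂ) : ‖circleFold R z‖ ≤ R := by
  by_cases hz : ‖z‖ < R
  · simpa [circleFold, hz] using hz.le
  · rw [circleFold, if_neg hz, norm_div, norm_pow, Complex.norm_real, Complex.norm_conj,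
      Real.norm_of_nonneg hR]
    exact div_le_of_le_mul₀ (norm_nonneg _) hR (by nlinarith)

lemma norm_sub_smul_le {s : ℝ} {z w : ℂ} (hz : ‖z‖ ^ 2 ≤ s * ‖w‖ ^ 2) (hs : s ≤ 1) :
    ‖z - (s : ℂ) * w‖ ≤ ‖z - w‖ := by
  refine le_of_sq_le_sq ?_ (norm_nonneg _)
  simp only [Complex.sq_norm, Complex.normSq_apply] at *
  simp only [Complex.sub_re, Complex.sub_im, Complex.mul_re, Complex.mul_im, Complex.ofReal_re,
    Complex.ofReal_im, zero_mul, sub_zero, add_zero]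
  nlinarith [mul_nonneg (sub_nonneg.2 hs) (sub_nonneg.2 hz),
    mul_nonneg (sub_nonneg.2 hs) (add_nonneg (sq_nonneg (z.re - w.re)) (sq_nonneg (z.im - w.im)))]

lemma lipschitzWith_circleFold {R : ℝ} (hR : 0 ≤ R) : LipschitzWith 1 (circleFold R) := by
  have mixed : ∀ z w : ℂ, ‖z‖ < R → R ≤ ‖w‖ → ‖circleFold R z - circleFold R w‖ ≤ ‖z - w‖ := by
    intro z w hz hw
    have hw0 : 0 < ‖w‖ := (norm_nonneg z).trans_lt (hz.trans_le hw)
    rw [circleFold_eq_smul hw, circleFold, if_pos hz]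
    refine norm_sub_smul_le ?_ ?_
    · rw [div_mul_cancel₀ _ (by positivity)]
      gcongr
    · exact div_le_one_of_le₀ (by gcongr) (by positivity)
  refine LipschitzWith.of_dist_le_mul fun z w => ?_
  rw [dist_eq_norm, dist_eq_norm, NNReal.coe_one, one_mul]
  rcases lt_or_ge ‖z‖ R with hz | hz <;> rcases lt_or_ge ‖w‖ R with hw | hw
  · simp [circleFold, hz, hw]
  · exact mixed z w hz hw
  · rw [norm_sub_rev, norm_sub_rev z]
    exact mixed w z hw hz
  · rcases hR.eq_or_lt with rfl | hR
    · simp [circleFold, (norm_nonneg z).not_gt, (norm_nonneg w).not_gt]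
    have hz0 : (starRingEnd ℂ) z ≠ 0 := by
      simpa using norm_pos_iff.1 (hR.trans_le hz)
    have hw0 : (starRingEnd ℂ) w ≠ 0 := by
      simpa using norm_pos_iff.1 (hR.trans_le hw)
    have key : circleFold R z - circleFold R w =
        (R : ℂ) ^ 2 * (starRingEnd ℂ) (w - z) / ((starRingEnd ℂ) z * (starRingEnd ℂ) w) := by
      rw [circleFold, circleFold, if_neg hz.not_gt, if_neg hw.not_gt, map_sub]
      field_simp
    rw [key, norm_div, norm_mul, norm_mul, norm_pow, Complex.norm_real, Complex.norm_conj,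
      Complex.norm_conj, Complex.norm_conj, Real.norm_of_nonneg hR.le, norm_sub_rev w]
    refine div_le_of_le_mul₀ (by positivity) (norm_nonneg _) ?_
    rw [mul_comm]
    gcongr
    nlinarith

lemma plasmonWave_eq_re (R : ℝ) (k : ℕ) (z : ℂ) :
    plasmonWave R k z = (circleFold R z ^ k).re := by
  rw [plasmonWave, circleFold]
  split_ifs
  · rfl
  · rw [div_pow, ← pow_mul, div_eq_mul_inv, ← map_pow, ← map_inv₀, ← Complex.ofReal_pow,
      Complex.re_ofReal_mul, Complex.conj_re, zpow_neg, zpow_natCast]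

lemma continuous_plasmonWave {R : ℝ} (hR : 0 ≤ R) {k : ℕ} : Continuous (plasmonWave R k) := by
  rw [funext (plasmonWave_eq_re R k)]
  exact Complex.continuous_re.comp ((lipschitzWith_circleFold hR).continuous.pow k)

/-- The stream function of `A₀ ∇ψ̂_k`: its rotated gradient is `A₀ ∇ψ̂_k`. -/
def plasmonStream (R : ℝ) (k : ℕ) (z : ℂ) : ℝ := -(circleFold R z ^ k).im

lemma norm_pow_sub_pow_le {R : ℝ} {a b : ℂ} (ha : ‖a‖ ≤ R) (hb : ‖b‖ ≤ R) (k : ℕ) :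
    ‖a ^ k - b ^ k‖ ≤ k * R ^ (k - 1) * ‖a - b‖ := by
  refine (convex_closedBall (0 : ℂ) R).norm_image_sub_le_of_norm_hasDerivWithin_le
    (f := fun z : ℂ => z ^ k) (fun z _ => (hasDerivAt_pow k z).hasDerivWithinAt) ?_
    (by simpa using hb) (by simpa using ha)
  intro z hz
  have hz : ‖z‖ ≤ R := by simpa using hz
  rw [norm_mul, norm_pow, Complex.norm_natCast]
  gcongr

lemma lipschitzWith_plasmonStream {R : ℝ} (hR : 0 ≤ R) (k : ℕ) :
    LipschitzWith (Real.toNNReal (k * R ^ (k - 1))) (plasmonStream R k) := by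
  refine LipschitzWith.of_dist_le' fun z w => ?_
  have h1 := norm_pow_sub_pow_le (norm_circleFold_le hR z) (norm_circleFold_le hR w) k
  have h2 : ‖circleFold R z - circleFold R w‖ ≤ dist z w := by
    simpa [dist_eq_norm] using (lipschitzWith_circleFold hR).dist_le_mul z w
  calc dist (plasmonStream R k z) (plasmonStream R k w)
      = |(circleFold R z ^ k - circleFold R w ^ k).im| := by
        rw [plasmonStream, plasmonStream, dist_neg_neg, Real.dist_eq, Complex.sub_im]
    _ ≤ ‖circleFold R z ^ k - circleFold R w ^ k‖ := Complex.abs_im_le_norm _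
    _ ≤ k * R ^ (k - 1) * dist z w := h1.trans (by gcongr)

lemma HasDerivAt.fderiv_re_apply {G : ℂ → ℂ} {c z : ℂ} (h : HasDerivAt G c z) (v : ℂ) :
    fderiv ℝ (fun z => (G z).re) z v = (c * v).re := by
  have := Complex.reCLM.hasFDerivAt.comp z (h.hasFDerivAt.restrictScalars ℝ)
  rw [show (fun z => (G z).re) = Complex.reCLM ∘ G from rfl, this.fderiv]
  simp [mul_comm]

lemma HasDerivAt.fderiv_im_apply {G : ℂ → ℂ} {c z : ℂ} (h : HasDerivAt G c z) (v : ℂ) :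
    fderiv ℝ (fun z => (G z).im) z v = (c * v).im := by
  have := Complex.imCLM.hasFDerivAt.comp z (h.hasFDerivAt.restrictScalars ℝ)
  rw [show (fun z => (G z).im) = Complex.imCLM ∘ G from rfl, this.fderiv]
  simp [mul_comm]

/-- Off the circle, `∇ψ̂_k` is the conjugate of a complex number `c` of size `O((1 + |z|²)⁻¹)`,
and `A₀ ∇ψ̂_k` is the rotated gradient of `plasmonStream`. -/
lemma exists_plasmon_derivative {R : ℝ} (hR : 0 < R) {k : ℕ} (hk : 1 ≤ k) {z : ℂ}
    (hz : ‖z‖ ≠ R) :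
    ∃ c : ℂ, ‖c‖ ≤ k * R ^ (k - 1) * (1 + R ^ 2) * (1 + ‖z‖ ^ 2)⁻¹ ∧
      fderiv ℝ (plasmonWave R k) z 1 = c.re ∧
      fderiv ℝ (plasmonWave R k) z Complex.I = -c.im ∧
      grad2R (plasmonStream R k) z = corelessA R z * c.re ∧
      grad1R (plasmonStream R k) z = corelessA R z * c.im := by
  rcases hz.lt_or_gt with hz | hz
  · have hev : ∀ᶠ y in nhds z, ‖y‖ < R := continuous_norm.continuousAt.eventually_lt_const hz
    have hG := hasDerivAt_pow k z
    have hψ : plasmonWave R k =ᶠ[nhds z] fun y => (y ^ k).re :=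
      hev.mono fun y hy => by rw [plasmonWave, if_pos hy]
    have hw : plasmonStream R k =ᶠ[nhds z] fun y => -(y ^ k).im :=
      hev.mono fun y hy => by rw [plasmonStream, circleFold, if_pos hy]
    refine ⟨_, ?_, by rw [hψ.fderiv_eq, hG.fderiv_re_apply, mul_one],
      by rw [hψ.fderiv_eq, hG.fderiv_re_apply, Complex.mul_I_re], ?_, ?_⟩
    · rw [norm_mul, norm_pow, Complex.norm_natCast, mul_assoc (_ * _)]
      have : 1 ≤ (1 + R ^ 2) * (1 + ‖z‖ ^ 2)⁻¹ := by
        rw [← div_eq_mul_inv, one_le_div (by positivity)]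
        gcongr
      refine le_trans ?_ (le_mul_of_one_le_right (by positivity) this)
      gcongr
    · rw [grad2R, hw.fderiv_eq, fderiv_fun_neg, neg_apply, hG.fderiv_im_apply,
        Complex.mul_I_im, corelessA, if_pos hz.le, neg_one_mul]
    · rw [grad1R, hw.fderiv_eq, fderiv_fun_neg, neg_apply, hG.fderiv_im_apply,
        mul_one, corelessA, if_pos hz.le, neg_one_mul]
  · have hz0 : z ≠ 0 := norm_pos_iff.1 (hR.trans hz)
    have hev : ∀ᶠ y in nhds z, ¬ ‖y‖ < R :=
      (continuous_norm.continuousAt.eventually_const_lt hz).mono fun y hy => hy.not_gt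
    have hG := (hasDerivAt_zpow (-(k : ℤ)) z (Or.inl hz0)).const_mul (((R ^ (2 * k) : ℝ)) : ℂ)
    have hψ : plasmonWave R k =ᶠ[nhds z]
        fun y => (((R ^ (2 * k) : ℝ) : ℂ) * y ^ (-(k : ℤ))).re :=
      hev.mono fun y hy => by
        dsimp only
        rw [plasmonWave, if_neg hy, Complex.re_ofReal_mul]
    have hw : plasmonStream R k =ᶠ[nhds z]
        fun y => (((R ^ (2 * k) : ℝ) : ℂ) * y ^ (-(k : ℤ))).im :=
      hev.mono fun y hy => by
        dsimp only
        rw [plasmonStream, circleFold, if_neg hy, div_pow, ← pow_mul, div_eq_mul_inv, ← map_pow,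
          ← map_inv₀, ← Complex.ofReal_pow, Complex.im_ofReal_mul, Complex.conj_im, zpow_neg,
          zpow_natCast, Complex.im_ofReal_mul, mul_neg, neg_neg]
    refine ⟨_, ?_, by rw [hψ.fderiv_eq, hG.fderiv_re_apply, mul_one],
      by rw [hψ.fderiv_eq, hG.fderiv_re_apply, Complex.mul_I_re], ?_, ?_⟩
    · obtain ⟨m, rfl⟩ := Nat.exists_eq_add_of_le' hk
      have hexp : (-((m + 1 : ℕ) : ℤ) - 1) = -((m + 2 : ℕ) : ℤ) := by push_cast; ring
      rw [hexp, zpow_neg, zpow_natCast]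
      simp only [norm_mul, norm_inv, norm_pow, Complex.norm_real, Int.cast_neg, norm_neg,
        Int.cast_natCast, Complex.norm_natCast, Real.norm_of_nonneg hR.le, Nat.add_sub_cancel]
      have hr : 0 < ‖z‖ := hR.trans hz
      have hle : R ^ m * (R ^ 2 * (1 + ‖z‖ ^ 2)) ≤ ‖z‖ ^ m * ((1 + R ^ 2) * ‖z‖ ^ 2) := by
        refine mul_le_mul (by gcongr) ?_ (by positivity) (by positivity)
        nlinarith
      rw [← div_eq_mul_inv, ← div_eq_mul_inv, ← mul_div_assoc,
        div_le_div_iff₀ (by positivity) (by positivity)]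
      have := mul_le_mul_of_nonneg_left hle
        (show 0 ≤ ((m + 1 : ℕ) : ℝ) * R ^ m by positivity)
      convert this using 1 <;> ring
    · rw [grad2R, hw.fderiv_eq, hG.fderiv_im_apply, Complex.mul_I_im, corelessA,
        if_neg hz.not_ge, one_mul]
    · rw [grad1R, hw.fderiv_eq, hG.fderiv_im_apply, mul_one, corelessA, if_neg hz.not_ge, one_mul]

lemma ae_norm_ne (R : ℝ) : ∀ᵐ z : ℂ, ‖z‖ ≠ R := by
  have h : volume (Metric.sphere (0 : ℂ) R) = 0 := Measure.addHaar_sphere volume 0 R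
  filter_upwards [measure_eq_zero_iff_ae_notMem.1 h] with z hz
  simpa using hz

lemma integrable_gradSqR_plasmonWave {R : ℝ} (hR : 0 < R) {k : ℕ} (hk : 1 ≤ k) :
    Integrable (gradSqR (plasmonWave R k)) := by
  have hdom : Integrable (fun z : ℂ => (1 + ‖z‖ ^ 2) ^ (-(4 : ℝ) / 2)) :=
    integrable_rpow_neg_one_add_norm_sq (by rw [Complex.finrank_real_complex]; norm_num)
  refine (hdom.const_mul ((k * R ^ (k - 1) * (1 + R ^ 2)) ^ 2)).mono' ?_ ?_
  · exact (((measurable_fderiv_apply_const ℝ _ 1).pow_const 2).add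
      ((measurable_fderiv_apply_const ℝ _ Complex.I).pow_const 2)).aestronglyMeasurable
  · filter_upwards [ae_norm_ne R] with z hz
    obtain ⟨c, hc, h1, hI, -⟩ := exists_plasmon_derivative hR hk hz
    have hrpow : (1 + ‖z‖ ^ 2) ^ (-(4 : ℝ) / 2) = ((1 + ‖z‖ ^ 2)⁻¹) ^ 2 := by
      rw [show (-(4 : ℝ) / 2) = -((2 : ℕ) : ℝ) by norm_num,
        Real.rpow_neg (by positivity), Real.rpow_natCast, inv_pow]
    have hsq : gradSqR (plasmonWave R k) z = ‖c‖ ^ 2 := by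
      rw [gradSqR, grad1R, grad2R, h1, hI, Complex.sq_norm, Complex.normSq_apply]
      ring
    rw [hsq, hrpow, ← mul_pow, Real.norm_of_nonneg (by positivity)]
    gcongr

/-- The rotated gradient of a Lipschitz function is weakly divergence free. -/
lemma integral_rotated_grad_mul_grad_eq_zero {w φ : ℂ → ℝ} {C : NNReal} (hw : LipschitzWith C w)
    (hφ : ContDiff ℝ 2 φ) (hc : HasCompactSupport φ) :
    ∫ z, (grad2R w z * grad1R φ z - grad1R w z * grad2R φ z) = 0 := by
  have hd (v : ℂ) : ContDiff ℝ 1 (fun z => fderiv ℝ φ z v) :=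
    (hφ.fderiv_right (m := 1) (by norm_num)).clm_apply contDiff_const
  have hint (u v : ℂ) : Integrable (fun z => fderiv ℝ w z u * fderiv ℝ φ z v) := by
    refine ((hd v).continuous.integrable_of_hasCompactSupport (hc.fderiv_apply ℝ v)).bdd_mul
      (c := C * ‖u‖) (measurable_fderiv_apply_const ℝ _ u).aestronglyMeasurable
      (Eventually.of_forall fun z => ?_)
    exact (fderiv ℝ w z).le_of_opNorm_le (norm_fderiv_le_of_lipschitz ℝ hw) u
  have hparts (u v : ℂ) : ∫ z, fderiv ℝ w z u * fderiv ℝ φ z v =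
      ∫ z, -(fderiv ℝ (fderiv ℝ φ) z u v) * w z := by
    obtain ⟨D, hD⟩ := (hd v).lipschitzWith_of_hasCompactSupport (hc.fderiv_apply ℝ v) one_ne_zero
    calc ∫ z, fderiv ℝ w z u * fderiv ℝ φ z v
        = ∫ z, lineDeriv ℝ w z u * fderiv ℝ φ z v := by
          refine integral_congr_ae ?_
          filter_upwards [hw.ae_differentiableAt] with z hz
          rw [hz.lineDeriv_eq_fderiv]
      _ = ∫ z, lineDeriv ℝ (fun z => fderiv ℝ φ z v) z (-u) * w z :=
          hw.integral_lineDeriv_mul_eq hD (hc.fderiv_apply ℝ v) u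
      _ = ∫ z, -(fderiv ℝ (fderiv ℝ φ) z u v) * w z := by
          refine integral_congr_ae (Eventually.of_forall fun z => ?_)
          have h2 : DifferentiableAt ℝ (fderiv ℝ φ) z :=
            (hφ.fderiv_right (m := 1) (by norm_num)).differentiable one_ne_zero z
          have hlin : fderiv ℝ (fun z => fderiv ℝ φ z v) z u = fderiv ℝ (fderiv ℝ φ) z u v := by
            rw [fderiv_clm_apply h2 (differentiableAt_const v)]
            simp
          simp only []
          rw [((hd v).differentiable one_ne_zero z).lineDeriv_eq_fderiv, map_neg, hlin]
  simp only [grad1R, grad2R]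
  rw [integral_sub (hint _ _) (hint _ _), hparts, hparts, sub_eq_zero]
  refine integral_congr_ae (Eventually.of_forall fun z => ?_)
  simp only []
  rw [(hφ.contDiffAt.isSymmSndFDerivAt (by simp)).eq Complex.I 1]

/-- the perfect plasmon wave is continuous, has square-integrable gradient,
and is a weak solution of `∇·(A₀ ∇ψ̂_k) = 0`. -/
theorem plasmonWave_weak_solution (R : ℝ) (hR : 0 < R) (k : ℕ) (hk : 1 ≤ k) :
    Continuous (plasmonWave R k) ∧
    Integrable (gradSqR (plasmonWave R k)) volume ∧
    ∀ φ : ℂ → ℝ, ContDiff ℝ (⊤ : ℕ∞) φ → HasCompactSupport φ →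
      (∫ z : ℂ, corelessA R z * gradDotR (plasmonWave R k) φ z) = 0 := by
  refine ⟨continuous_plasmonWave hR.le, integrable_gradSqR_plasmonWave hR hk, fun φ hφ hc => ?_⟩
  have hw := lipschitzWith_plasmonStream hR.le k
  rw [← integral_rotated_grad_mul_grad_eq_zero hw (hφ.of_le (WithTop.coe_le_coe.2 le_top)) hc]
  refine integral_congr_ae ?_
  filter_upwards [ae_norm_ne R] with z hz
  obtain ⟨c, -, h1, hI, h2, h3⟩ := exists_plasmon_derivative hR hk hz
  rw [gradDotR, grad1R, grad2R, h1, hI, h2, h3]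
  simp only [grad1R, grad2R]
  ring
end
end

section
/- Let ρ > 0 and z₀ ∈ ℂ with |z₀| < ρ (so that 0 lies inside the disk B_ρ(z₀)), and let k, m ≥ 0 be integers with k + m ≥ 1. Then the integral over the circle ∂B_ρ(z₀) of the function z ↦ (conj(z))^{−k}·(z − z₀)^m with respect to arclength vanishes: ρ·∫_0^{2π} (conj(z₀ + ρe^{iθ}))^{−k} · (ρe^{iθ})^m dθ = 0. -/
open MeasureTheory Real Filter

noncomputable section

open scoped Classical

/-- On the circle `‖w‖ = ρ`, the function `conj (z₀ + w) ^ (-k) * w ^ m` agrees with a rational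
function of `w`, because `conj w = ρ ^ 2 / w` there. -/
lemma conj_add_zpow_neg_mul_pow {ρ : ℝ} (hρ : 0 < ρ) (z₀ : ℂ) {w : ℂ} (hw : ‖w‖ = ρ) (k m : ℕ) :
    (starRingEnd ℂ (z₀ + w)) ^ (-(k : ℤ)) * w ^ m =
      w ^ (k + m) / ((ρ : ℂ) ^ 2 + starRingEnd ℂ z₀ * w) ^ k := by
  have hw0 : w ≠ 0 := norm_pos_iff.mp (hw ▸ hρ)
  have hconj : starRingEnd ℂ (z₀ + w) = ((ρ : ℂ) ^ 2 + starRingEnd ℂ z₀ * w) / w := by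
    rw [eq_div_iff hw0, map_add, add_mul, mul_comm (starRingEnd ℂ w) w, Complex.mul_conj', hw,
      add_comm]
  rw [hconj, zpow_neg, zpow_natCast, div_pow, inv_div, pow_add]
  ring

/-- The denominator `ρ ^ 2 + a * w` does not vanish on the disk `‖w‖ ≤ ρ` if `‖a‖ < ρ`. -/
lemma sq_add_mul_ne_zero {ρ : ℝ} {a w : ℂ} (hρ : 0 < ρ) (ha : ‖a‖ < ρ) (hw : ‖w‖ ≤ ρ) :
    (ρ : ℂ) ^ 2 + a * w ≠ 0 := by
  intro h
  have hnorm : ρ ^ 2 = ‖a‖ * ‖w‖ := by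
    rw [← norm_mul, ← norm_neg (a * w), ← eq_neg_of_add_eq_zero_left h, norm_pow,
      Complex.norm_real, Real.norm_of_nonneg hρ.le]
  nlinarith [mul_le_mul_of_nonneg_left hw (norm_nonneg a)]

/-- for `|z₀| < ρ` and integers `k, m ≥ 0` with `k + m ≥ 1`, the integral
over the circle `∂B_ρ(z₀)` of `z ↦ conj(z)^{-k}·(z-z₀)^m` with respect to arclength
vanishes. -/
theorem conj_interaction_vanishes
    (ρ : ℝ) (hρ : 0 < ρ) (z₀ : ℂ) (hz₀ : ‖z₀‖ < ρ) (k m : ℕ) (hkm : 1 ≤ k + m) :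
    (ρ : ℂ) * ∫ θ in (0:ℝ)..(2 * π),
        ((starRingEnd ℂ) (z₀ + (ρ : ℂ) * Complex.exp ((θ : ℂ) * Complex.I))) ^ (-(k:ℤ)) *
          ((ρ : ℂ) * Complex.exp ((θ : ℂ) * Complex.I)) ^ m = 0 := by
  set g : ℂ → ℂ := fun w => w ^ (k + m) / ((ρ : ℂ) ^ 2 + starRingEnd ℂ z₀ * w) ^ k with hg
  have hdiff : DiffContOnCl ℂ g (Metric.ball 0 |ρ|) := by
    refine DifferentiableOn.diffContOnCl fun w hw => ?_
    rw [abs_of_pos hρ, closure_ball _ hρ.ne', mem_closedBall_zero_iff] at hw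
    have hden : ((ρ : ℂ) ^ 2 + starRingEnd ℂ z₀ * w) ^ k ≠ 0 :=
      pow_ne_zero _ (sq_add_mul_ne_zero hρ (by rwa [Complex.norm_conj]) hw)
    have hgw : DifferentiableAt ℂ g w := by
      fun_prop (disch := exact hden)
    exact hgw.differentiableWithinAt
  have hmean : (2 * π)⁻¹ • ∫ θ in (0:ℝ)..(2 * π), g (circleMap 0 ρ θ) = 0 := by
    rw [← Real.circleAverage_def, hdiff.circleAverage]
    rw [hg]
    beta_reduce
    rw [zero_pow (by lia), zero_div]
  have hint : ∫ θ in (0:ℝ)..(2 * π), g (circleMap 0 ρ θ) = 0 :=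
    (smul_eq_zero.mp hmean).resolve_left (by positivity)
  rw [← mul_zero (ρ : ℂ), ← hint]
  congr 2 with θ
  rw [conj_add_zpow_neg_mul_pow hρ z₀ (by simp [Complex.norm_exp_ofReal_mul_I, hρ.le])]
  simp [hg, circleMap]
end
end

section
/- (Explicit formula for the interaction coefficients.) Let ρ > 0 and z₀ ∈ ℂ with |z₀| < ρ, and for integers m, k ≥ 0 define the interaction coefficient I_{m,k} := ∫_{∂B_ρ(z₀)} Re(z^{−k})·(z − z₀)^m dH¹(z) = ρ·∫_0^{2π} Re((z₀ + ρe^{iθ})^{−k})·(ρe^{iθ})^m dθ ∈ ℂ. Then: (i) for m ≥ 1 and k ≥ 0, I_{m,k} = 0 when m < k, and I_{m,k} = (−1)^{m−k}·π·ρ·binom(m−1, m−k)·z₀^{m−k} when m ≥ k; (ii) for m = 0, I_{0,k} = 2πρ if k = 0 and I_{0,k} = 0 if k ≥ 1. -/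
open MeasureTheory Real Filter

noncomputable section

open scoped Classical

/-- The interaction coefficient
`I_{m,k} = ∫_{∂B_ρ(z₀)} Re(z^{-k})·(z-z₀)^m dH¹(z)`, computed with the parametrization
`θ ↦ z₀ + ρ e^{iθ}` and `dH¹ = ρ dθ`. -/
def interactionCoeff (ρ : ℝ) (z₀ : ℂ) (m k : ℕ) : ℂ :=
  (ρ : ℂ) * ∫ θ in (0:ℝ)..(2 * π),
      (((z₀ + (ρ : ℂ) * Complex.exp ((θ : ℂ) * Complex.I)) ^ (-(k:ℤ))).re : ℂ) *
        ((ρ : ℂ) * Complex.exp ((θ : ℂ) * Complex.I)) ^ m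

/-- The holomorphic half of the interaction integral. -/
def holomorphicMoment (ρ : ℝ) (z₀ : ℂ) (m k : ℕ) : ℂ :=
  ∫ θ in (0:ℝ)..(2 * π), ((z₀ + circleMap 0 ρ θ) ^ k)⁻¹ * circleMap 0 ρ θ ^ m

/-- The antiholomorphic half of the interaction integral. -/
def antiholomorphicMoment (ρ : ℝ) (z₀ : ℂ) (m k : ℕ) : ℂ :=
  ∫ θ in (0:ℝ)..(2 * π),
    (starRingEnd ℂ) ((z₀ + circleMap 0 ρ θ) ^ k)⁻¹ * circleMap 0 ρ θ ^ m

theorem add_circleMap_ne_zero {ρ : ℝ} {z₀ : ℂ} (hz₀ : ‖z₀‖ < ρ) (θ : ℝ) :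
    z₀ + circleMap 0 ρ θ ≠ 0 := by
  intro h
  have hnorm : ‖circleMap 0 ρ θ‖ = ‖z₀‖ := by
    rw [eq_neg_of_add_eq_zero_right h, norm_neg]
  rw [norm_circleMap_zero, abs_of_pos ((norm_nonneg z₀).trans_lt hz₀)] at hnorm
  exact hz₀.ne' hnorm

theorem continuous_inv_pow_add_circleMap {ρ : ℝ} {z₀ : ℂ} (hz₀ : ‖z₀‖ < ρ) (k : ℕ) :
    Continuous fun θ : ℝ ↦ ((z₀ + circleMap 0 ρ θ) ^ k)⁻¹ :=
  ((continuous_const.add (continuous_circleMap 0 ρ)).pow k).inv₀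
    fun θ ↦ pow_ne_zero k (add_circleMap_ne_zero hz₀ θ)

theorem intervalIntegrable_holomorphicMoment {ρ : ℝ} {z₀ : ℂ} (hz₀ : ‖z₀‖ < ρ) (m k : ℕ) :
    IntervalIntegrable (fun θ : ℝ ↦ ((z₀ + circleMap 0 ρ θ) ^ k)⁻¹ * circleMap 0 ρ θ ^ m)
      volume 0 (2 * π) :=
  ((continuous_inv_pow_add_circleMap hz₀ k).mul
    ((continuous_circleMap 0 ρ).pow m)).intervalIntegrable _ _

theorem intervalIntegrable_antiholomorphicMoment {ρ : ℝ} {z₀ : ℂ} (hz₀ : ‖z₀‖ < ρ) (m k : ℕ) :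
    IntervalIntegrable
      (fun θ : ℝ ↦ (starRingEnd ℂ) ((z₀ + circleMap 0 ρ θ) ^ k)⁻¹ * circleMap 0 ρ θ ^ m)
      volume 0 (2 * π) :=
  ((Complex.continuous_conj.comp (continuous_inv_pow_add_circleMap hz₀ k)).mul
    ((continuous_circleMap 0 ρ).pow m)).intervalIntegrable _ _

theorem interactionCoeff_eq_moments {ρ : ℝ} {z₀ : ℂ} (hz₀ : ‖z₀‖ < ρ) (m k : ℕ) :
    interactionCoeff ρ z₀ m k =
      ρ / 2 * (holomorphicMoment ρ z₀ m k + antiholomorphicMoment ρ z₀ m k) := by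
  rw [holomorphicMoment, antiholomorphicMoment, ← intervalIntegral.integral_add
    (intervalIntegrable_holomorphicMoment hz₀ m k)
    (intervalIntegrable_antiholomorphicMoment hz₀ m k), interactionCoeff, div_mul_eq_mul_div,
    mul_div_assoc, ← intervalIntegral.integral_div]
  congr 2
  ext θ
  rw [← circleMap_zero, Complex.re_eq_add_conj, zpow_neg, zpow_natCast]
  ring

theorem antiholomorphicMoment_eq_zero {ρ : ℝ} {z₀ : ℂ} (hz₀ : ‖z₀‖ < ρ) {m k : ℕ}
    (hmk : m + k ≠ 0) : antiholomorphicMoment ρ z₀ m k = 0 := by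
  have hρ : 0 < ρ := (norm_nonneg z₀).trans_lt hz₀
  let g : ℂ → ℂ := fun w ↦ ((starRingEnd ℂ z₀ * w + ρ ^ 2) ^ k)⁻¹ * w ^ (m + k)
  have hden : ∀ w ∈ Metric.closedBall (0 : ℂ) |ρ|, starRingEnd ℂ z₀ * w + ρ ^ 2 ≠ 0 := by
    intro w hw h
    rw [mem_closedBall_zero_iff, abs_of_pos hρ] at hw
    have hnorm : ‖z₀‖ * ‖w‖ = ρ ^ 2 := by
      have := congrArg norm (eq_neg_of_add_eq_zero_left h)
      simpa using this
    nlinarith [norm_nonneg z₀, norm_nonneg w]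
  have hg : DifferentiableOn ℂ g (Metric.closedBall 0 |ρ|) := by
    refine DifferentiableOn.mul (DifferentiableOn.inv (by fun_prop) ?_) (by fun_prop)
    exact fun w hw ↦ pow_ne_zero k (hden w hw)
  have havg : circleAverage g 0 ρ = g 0 :=
    (hg.diffContOnCl_ball subset_rfl).circleAverage
  have hzero : g 0 = 0 := by simp only [g, zero_pow hmk, mul_zero]
  rw [hzero, circleAverage_def, smul_eq_zero] at havg
  have hint := havg.resolve_left (by positivity)
  rw [← hint, antiholomorphicMoment]
  congr 1
  ext θ
  have hw : circleMap 0 ρ θ ≠ 0 := circleMap_ne_center hρ.ne'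
  have hconj : starRingEnd ℂ z₀ * circleMap 0 ρ θ + ρ ^ 2 =
      starRingEnd ℂ (z₀ + circleMap 0 ρ θ) * circleMap 0 ρ θ := by
    rw [map_add, add_mul, Complex.conj_mul', norm_circleMap_zero, abs_of_pos hρ]
  simp only [g]
  rw [hconj, map_inv₀, map_pow, mul_pow, mul_inv, pow_add]
  field_simp

theorem holomorphicMoment_zero_zero (ρ : ℝ) (z₀ : ℂ) : holomorphicMoment ρ z₀ 0 0 = 2 * π := by
  simp [holomorphicMoment]

theorem antiholomorphicMoment_zero_zero (ρ : ℝ) (z₀ : ℂ) :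
    antiholomorphicMoment ρ z₀ 0 0 = 2 * π := by
  simp [antiholomorphicMoment]

theorem holomorphicMoment_zero_left {ρ : ℝ} {z₀ : ℂ} (hz₀ : ‖z₀‖ < ρ) {k : ℕ} (hk : k ≠ 0) :
    holomorphicMoment ρ z₀ 0 k = 0 := by
  have h := antiholomorphicMoment_eq_zero hz₀ (m := 0) (k := k) (by simpa using hk)
  simp only [antiholomorphicMoment, pow_zero, mul_one, intervalIntegral.intervalIntegral_conj] at h
  simpa [holomorphicMoment] using h

theorem holomorphicMoment_zero_right {ρ : ℝ} {z₀ : ℂ} (hz₀ : ‖z₀‖ < ρ) {m : ℕ} (hm : m ≠ 0) :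
    holomorphicMoment ρ z₀ m 0 = 0 := by
  simpa [antiholomorphicMoment, holomorphicMoment] using
    antiholomorphicMoment_eq_zero hz₀ (m := m) (k := 0) (by simpa using hm)

theorem holomorphicMoment_succ_succ {ρ : ℝ} {z₀ : ℂ} (hz₀ : ‖z₀‖ < ρ) (m k : ℕ) :
    holomorphicMoment ρ z₀ (m + 1) (k + 1) =
      holomorphicMoment ρ z₀ m k - z₀ * holomorphicMoment ρ z₀ m (k + 1) := by
  simp only [holomorphicMoment]
  rw [← intervalIntegral.integral_const_mul, ← intervalIntegral.integral_sub
    (intervalIntegrable_holomorphicMoment hz₀ m k)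
    ((intervalIntegrable_holomorphicMoment hz₀ m (k + 1)).const_mul z₀)]
  congr 1
  ext θ
  have hz := add_circleMap_ne_zero hz₀ θ
  field_simp
  ring

theorem holomorphicMoment_succ_succ_eq {ρ : ℝ} {z₀ : ℂ} (hz₀ : ‖z₀‖ < ρ) (m k : ℕ) :
    holomorphicMoment ρ z₀ (m + 1) (k + 1) = 2 * π * m.choose k * (-z₀) ^ (m - k) := by
  induction m generalizing k with
  | zero =>
    rw [holomorphicMoment_succ_succ hz₀, holomorphicMoment_zero_left hz₀ k.succ_ne_zero]
    cases k with
    | zero => simp [holomorphicMoment_zero_zero]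
    | succ k => simp [holomorphicMoment_zero_left hz₀ k.succ_ne_zero]
  | succ m ih =>
    rw [holomorphicMoment_succ_succ hz₀, ih]
    cases k with
    | zero =>
      rw [holomorphicMoment_zero_right hz₀ m.succ_ne_zero]
      simp only [Nat.choose_zero_right, Nat.sub_zero, pow_succ]
      ring
    | succ k =>
      rw [ih, Nat.choose_succ_succ, Nat.add_sub_add_right]
      rcases lt_or_ge k m with hkm | hkm
      · rw [show m - k = m - (k + 1) + 1 by lia, pow_succ]
        push_cast
        ring
      · rw [Nat.choose_eq_zero_of_lt (Nat.lt_succ_of_le hkm)]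
        simp

/-- explicit formula for the interaction coefficients: for `m ≥ 1`,
`I_{m,k} = 0` if `m < k` and `I_{m,k} = (-1)^{m-k} π ρ C(m-1, m-k) z₀^{m-k}` if `m ≥ k`;
for `m = 0`, `I_{0,0} = 2πρ` and `I_{0,k} = 0` for `k ≥ 1`. -/
theorem interactionCoeff_formula (ρ : ℝ) (hρ : 0 < ρ) (z₀ : ℂ) (hz₀ : ‖z₀‖ < ρ) :
    (∀ m k : ℕ, 1 ≤ m → m < k → interactionCoeff ρ z₀ m k = 0) ∧
    (∀ m k : ℕ, 1 ≤ m → k ≤ m →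
      interactionCoeff ρ z₀ m k =
        (-1 : ℂ) ^ (m - k) * (π : ℂ) * (ρ : ℂ) *
          ((m - 1).choose (m - k) : ℂ) * z₀ ^ (m - k)) ∧
    interactionCoeff ρ z₀ 0 0 = 2 * (π : ℂ) * (ρ : ℂ) ∧
    (∀ k : ℕ, 1 ≤ k → interactionCoeff ρ z₀ 0 k = 0) := by
  refine ⟨fun m k hm hmk ↦ ?_, fun m k hm hkm ↦ ?_, ?_, fun k hk ↦ ?_⟩
  · obtain ⟨m, rfl⟩ := Nat.exists_eq_add_of_le' hm
    obtain ⟨k, rfl⟩ := Nat.exists_eq_add_of_le' (hm.trans hmk.le)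
    rw [interactionCoeff_eq_moments hz₀, holomorphicMoment_succ_succ_eq hz₀,
      antiholomorphicMoment_eq_zero hz₀ (by lia), Nat.choose_eq_zero_of_lt (by lia)]
    simp
  · obtain ⟨m, rfl⟩ := Nat.exists_eq_add_of_le' hm
    rw [interactionCoeff_eq_moments hz₀, antiholomorphicMoment_eq_zero hz₀ (by lia)]
    cases k with
    | zero =>
      rw [holomorphicMoment_zero_right hz₀ m.succ_ne_zero]
      simp
    | succ k =>
      rw [holomorphicMoment_succ_succ_eq hz₀, Nat.add_sub_add_right, Nat.add_sub_cancel,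
        Nat.choose_symm (by lia), neg_pow]
      ring
  · rw [interactionCoeff_eq_moments hz₀, holomorphicMoment_zero_zero,
      antiholomorphicMoment_zero_zero]
    ring
  · rw [interactionCoeff_eq_moments hz₀, holomorphicMoment_zero_left hz₀ (by lia),
      antiholomorphicMoment_eq_zero hz₀ (by lia)]
    simp
end
end

section
/- (Expansion of Re(z^{−k}) in harmonics centered at z₀.) Let ρ > 0 and z₀ ∈ ℂ with |z₀| < ρ, let k ≥ 1 be an integer, and let I_{m,k} := ∫_{∂B_ρ(z₀)} Re(w^{−k})·(w − z₀)^m dH¹(w) be the interaction coefficients. Then for every z on the circle |z − z₀| = ρ, the series ∑_{m≥k} (π ρ^{2m+1})^{−1}·conj(I_{m,k})·(z − z₀)^m converges absolutely and Re(z^{−k}) = Re( ∑_{m≥k} (π ρ^{2m+1})^{−1}·conj(I_{m,k})·(z − z₀)^m ). -/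
open MeasureTheory Real Filter

noncomputable section

open scoped Classical

/-- The coefficient of `u ^ (-(l + 1 + j))` in the expansion of `(z₀ + u) ^ (-(l + 1))`. -/
def negPowCoeff (l : ℕ) (z₀ : ℂ) (j : ℕ) : ℂ :=
  ((j + l).choose l : ℂ) * (-z₀) ^ j

lemma negPowCoeff_mul_zpow (l : ℕ) (z₀ : ℂ) {u : ℂ} (hu : u ≠ 0) (j : ℕ) :
    negPowCoeff l z₀ j * u ^ (-((l + 1 + j : ℕ) : ℤ)) =
      (u ^ (l + 1))⁻¹ * (((j + l).choose l : ℂ) * (-z₀ / u) ^ j) := by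
  rw [negPowCoeff, zpow_neg, zpow_natCast, pow_add _ (l + 1), div_pow]
  field_simp

lemma norm_neg_div_lt_one {z₀ u : ℂ} (h : ‖z₀‖ < ‖u‖) : ‖-z₀ / u‖ < 1 := by
  rw [norm_div, norm_neg]
  exact (div_lt_one ((norm_nonneg _).trans_lt h)).2 h

lemma hasSum_negPowCoeff {l : ℕ} {z₀ u : ℂ} (h : ‖z₀‖ < ‖u‖) :
    HasSum (fun j : ℕ => negPowCoeff l z₀ j * u ^ (-((l + 1 + j : ℕ) : ℤ)))
      ((z₀ + u) ^ (-((l + 1 : ℕ) : ℤ))) := by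
  have hu : u ≠ 0 := norm_pos_iff.1 ((norm_nonneg _).trans_lt h)
  have hs := (hasSum_choose_mul_geometric_of_norm_lt_one l (norm_neg_div_lt_one h)).mul_left
    (u ^ (l + 1))⁻¹
  simp only [negPowCoeff_mul_zpow l z₀ hu]
  have hval : (z₀ + u) ^ (-((l + 1 : ℕ) : ℤ)) =
      (u ^ (l + 1))⁻¹ * (1 / (1 - -z₀ / u) ^ (l + 1)) := by
    rw [zpow_neg, zpow_natCast, one_div, ← mul_inv, ← mul_pow]
    congr 2
    field_simp
    ring
  rw [hval]
  exact hs

lemma summable_norm_negPowCoeff {l : ℕ} {z₀ u : ℂ} (h : ‖z₀‖ < ‖u‖) :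
    Summable (fun j : ℕ => ‖negPowCoeff l z₀ j * u ^ (-((l + 1 + j : ℕ) : ℤ))‖) :=
  (hasSum_negPowCoeff h).summable.norm

lemma conj_zpow_neg_natCast {ρ : ℝ} (hρ : 0 < ρ) {u : ℂ} (hu : ‖u‖ = ρ) (n : ℕ) :
    (starRingEnd ℂ) (u ^ (-(n : ℤ))) = ((ρ : ℂ) ^ (2 * n))⁻¹ * u ^ n := by
  have hu0 : u ≠ 0 := norm_pos_iff.1 (hu ▸ hρ)
  have hmul : (starRingEnd ℂ) u * u = (ρ : ℂ) ^ 2 := by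
    rw [Complex.conj_mul', hu]
  have hc : (starRingEnd ℂ) u ≠ 0 := by simpa using hu0
  rw [map_zpow₀, zpow_neg, zpow_natCast, pow_mul, ← hmul, mul_pow]
  field_simp

lemma integral_circle_zpow {ρ : ℝ} (n : ℤ) :
    ∫ θ in (0:ℝ)..(2 * π), ((ρ : ℂ) * Complex.exp ((θ : ℂ) * Complex.I)) ^ n =
      if n = 0 then 2 * (π : ℂ) else 0 := by
  split_ifs with hn
  · simp [hn]
  · have hc : (n : ℂ) * Complex.I ≠ 0 := by simp [hn]
    have he : ∀ θ : ℝ, ((ρ : ℂ) * Complex.exp ((θ : ℂ) * Complex.I)) ^ n =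
        (ρ : ℂ) ^ n * Complex.exp ((n : ℂ) * Complex.I * θ) := fun θ => by
      rw [mul_zpow, ← Complex.exp_int_mul]
      ring_nf
    simp only [he, intervalIntegral.integral_const_mul, integral_exp_mul_complex hc]
    have h1 : Complex.exp ((n : ℂ) * Complex.I * ((2 * π : ℝ) : ℂ)) = 1 := by
      rw [← Complex.exp_int_mul_two_pi_mul_I n]
      push_cast
      ring_nf
    rw [h1, Complex.ofReal_zero, mul_zero, Complex.exp_zero, sub_self, zero_div, mul_zero]

lemma norm_circle_point {ρ : ℝ} (hρ : 0 < ρ) (θ : ℝ) :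
    ‖(ρ : ℂ) * Complex.exp ((θ : ℂ) * Complex.I)‖ = ρ := by
  rw [norm_mul, Complex.norm_exp_ofReal_mul_I, mul_one, Complex.norm_real, norm_of_nonneg hρ.le]

/-- The real part of `a u ^ (-n)` times `u ^ m` on the circle `‖u‖ = ρ`, as a Laurent polynomial. -/
lemma ofReal_re_mul_zpow_mul_pow {ρ : ℝ} (hρ : 0 < ρ) {u : ℂ} (hu : ‖u‖ = ρ) (a : ℂ) (n m : ℕ) :
    ((a * u ^ (-(n : ℤ))).re : ℂ) * u ^ m =
      a / 2 * u ^ ((m : ℤ) - n) +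
        (starRingEnd ℂ) a / 2 * ((ρ : ℂ) ^ (2 * n))⁻¹ * u ^ ((n + m : ℕ) : ℤ) := by
  have hu0 : u ≠ 0 := norm_pos_iff.1 (hu ▸ hρ)
  rw [Complex.re_eq_add_conj, map_mul, conj_zpow_neg_natCast hρ hu, sub_eq_add_neg,
    zpow_add₀ hu0, zpow_natCast, zpow_natCast, pow_add]
  ring

lemma continuous_circle_zpow {ρ : ℝ} (hρ : 0 < ρ) (n : ℤ) :
    Continuous fun θ : ℝ => ((ρ : ℂ) * Complex.exp ((θ : ℂ) * Complex.I)) ^ n :=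
  Continuous.zpow₀ (by fun_prop) n fun θ =>
    Or.inl (norm_pos_iff.1 ((norm_circle_point hρ θ).symm ▸ hρ))

lemma integral_re_mul_zpow_mul_pow {ρ : ℝ} (hρ : 0 < ρ) (a : ℂ) {n : ℕ} (hn : n ≠ 0) (m : ℕ) :
    ∫ θ in (0:ℝ)..(2 * π),
      ((a * ((ρ : ℂ) * Complex.exp ((θ : ℂ) * Complex.I)) ^ (-(n : ℤ))).re : ℂ) *
        ((ρ : ℂ) * Complex.exp ((θ : ℂ) * Complex.I)) ^ m = if n = m then π * a else 0 := by
  simp only [fun θ : ℝ => ofReal_re_mul_zpow_mul_pow hρ (norm_circle_point hρ θ) a n m]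
  have hint : ∀ (b : ℂ) (p : ℤ), IntervalIntegrable
      (fun θ : ℝ => b * ((ρ : ℂ) * Complex.exp ((θ : ℂ) * Complex.I)) ^ p) volume 0 (2 * π) :=
    fun b p => (continuous_const.mul (continuous_circle_zpow hρ p)).intervalIntegrable _ _
  rw [intervalIntegral.integral_add (hint _ _) (hint _ _),
    intervalIntegral.integral_const_mul, intervalIntegral.integral_const_mul,
    integral_circle_zpow, integral_circle_zpow,
    if_neg (by omega : ((n + m : ℕ) : ℤ) ≠ 0)]
  by_cases h : n = m
  · simp only [h, sub_self, if_true]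
    ring
  · rw [if_neg h, if_neg (by omega)]
    ring

lemma hasSum_integral_re_mul_pow {ρ : ℝ} (hρ : 0 < ρ) {z₀ : ℂ} (hz₀ : ‖z₀‖ < ρ) (l m : ℕ) :
    HasSum
      (fun i : ℕ => ∫ θ in (0:ℝ)..(2 * π),
        ((negPowCoeff l z₀ i * ((ρ : ℂ) * Complex.exp ((θ : ℂ) * Complex.I)) ^
          (-((l + 1 + i : ℕ) : ℤ))).re : ℂ) *
          ((ρ : ℂ) * Complex.exp ((θ : ℂ) * Complex.I)) ^ m)
      (∫ θ in (0:ℝ)..(2 * π),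
        (((z₀ + (ρ : ℂ) * Complex.exp ((θ : ℂ) * Complex.I)) ^ (-((l + 1 : ℕ) : ℤ))).re : ℂ) *
          ((ρ : ℂ) * Complex.exp ((θ : ℂ) * Complex.I)) ^ m) := by
  have hlt : ∀ θ : ℝ, ‖z₀‖ < ‖(ρ : ℂ) * Complex.exp ((θ : ℂ) * Complex.I)‖ := fun θ => by
    rwa [norm_circle_point hρ]
  refine intervalIntegral.hasSum_integral_of_dominated_convergence
    (fun i _ => ‖negPowCoeff l z₀ i * (ρ : ℂ) ^ (-((l + 1 + i : ℕ) : ℤ))‖ * ρ ^ m)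
    (fun i => ?_) (fun i => ae_of_all _ fun θ _ => ?_) (ae_of_all _ fun θ _ => ?_)
    intervalIntegrable_const (ae_of_all _ fun θ _ => ?_)
  · have hc := continuous_circle_zpow hρ (-((l + 1 + i : ℕ) : ℤ))
    have hre : Continuous fun θ : ℝ => (((negPowCoeff l z₀ i *
        ((ρ : ℂ) * Complex.exp ((θ : ℂ) * Complex.I)) ^ (-((l + 1 + i : ℕ) : ℤ))).re : ℝ) : ℂ) :=
      Complex.continuous_ofReal.comp (Complex.continuous_re.comp (continuous_const.mul hc))
    exact (hre.mul (by fun_prop)).aestronglyMeasurable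
  · rw [norm_mul, norm_pow, norm_circle_point hρ, Complex.norm_real]
    refine mul_le_mul_of_nonneg_right ((Complex.abs_re_le_norm _).trans_eq ?_) (by positivity)
    rw [norm_mul, norm_mul, norm_zpow, norm_zpow, norm_circle_point hρ, Complex.norm_real,
      norm_of_nonneg hρ.le]
  · refine (summable_norm_negPowCoeff ?_).mul_right _
    rwa [Complex.norm_real, norm_of_nonneg hρ.le]
  · exact (Complex.hasSum_ofReal.2
      (Complex.hasSum_re (hasSum_negPowCoeff (hlt θ)))).mul_right _

lemma interactionCoeff_eq {ρ : ℝ} (hρ : 0 < ρ) {z₀ : ℂ} (hz₀ : ‖z₀‖ < ρ) (l j : ℕ) :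
    interactionCoeff ρ z₀ (l + 1 + j) (l + 1) = π * ρ * negPowCoeff l z₀ j := by
  have hsum := (hasSum_integral_re_mul_pow hρ hz₀ l (l + 1 + j)).tsum_eq
  have hint : ∀ i : ℕ, _ := fun i => integral_re_mul_zpow_mul_pow hρ (negPowCoeff l z₀ i)
    (by omega : l + 1 + i ≠ 0) (l + 1 + j)
  rw [interactionCoeff, ← hsum, tsum_congr hint,
    tsum_eq_single j fun i hi => if_neg (by omega), if_pos rfl]
  ring

/-- on the circle `|z - z₀| = ρ`, the function `Re(z^{-k})` is given by the
absolutely convergent expansion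
`Re(∑_{m ≥ k} (π ρ^{2m+1})⁻¹ conj(I_{m,k}) (z-z₀)^m)` (indexing `m = k + j`). -/
theorem re_zpow_expansion
    (ρ : ℝ) (hρ : 0 < ρ) (z₀ : ℂ) (hz₀ : ‖z₀‖ < ρ) (k : ℕ) (hk : 1 ≤ k)
    (z : ℂ) (hz : ‖z - z₀‖ = ρ) :
    Summable (fun j : ℕ =>
      ‖(((π * ρ ^ (2 * (k + j) + 1) : ℝ) : ℂ))⁻¹ *
        (starRingEnd ℂ) (interactionCoeff ρ z₀ (k + j) k) * (z - z₀) ^ (k + j)‖) ∧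
    (z ^ (-(k:ℤ))).re =
      (∑' j : ℕ,
        (((π * ρ ^ (2 * (k + j) + 1) : ℝ) : ℂ))⁻¹ *
          (starRingEnd ℂ) (interactionCoeff ρ z₀ (k + j) k) * (z - z₀) ^ (k + j)).re := by
  obtain ⟨l, rfl⟩ : ∃ l, k = l + 1 := ⟨k - 1, by omega⟩
  have hlt : ‖z₀‖ < ‖z - z₀‖ := hz.symm ▸ hz₀
  have hterm : ∀ j : ℕ, (((π * ρ ^ (2 * (l + 1 + j) + 1) : ℝ) : ℂ))⁻¹ *
      (starRingEnd ℂ) (interactionCoeff ρ z₀ (l + 1 + j) (l + 1)) * (z - z₀) ^ (l + 1 + j) =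
      (starRingEnd ℂ) (negPowCoeff l z₀ j * (z - z₀) ^ (-((l + 1 + j : ℕ) : ℤ))) := fun j => by
    have hρ' : (ρ : ℂ) ≠ 0 := by exact_mod_cast hρ.ne'
    have hπ : (π : ℂ) ≠ 0 := by exact_mod_cast pi_ne_zero
    rw [interactionCoeff_eq hρ hz₀, map_mul _ (negPowCoeff l z₀ j), conj_zpow_neg_natCast hρ hz]
    simp only [map_mul, Complex.conj_ofReal, Complex.ofReal_mul, Complex.ofReal_pow,
      pow_succ _ (2 * (l + 1 + j))]
    field_simp
  simp only [hterm, RCLike.norm_conj]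
  refine ⟨summable_norm_negPowCoeff hlt, ?_⟩
  rw [← Complex.conj_tsum, (hasSum_negPowCoeff hlt).tsum_eq, Complex.conj_re, add_sub_cancel]
end
end

section
/- (Summed estimate for the interaction coefficients.) Let ρ > 0 and z₀ ∈ ℂ with |z₀| < ρ, and let I_{m,k} := ∫_{∂B_ρ(z₀)} Re(z^{−k})·(z − z₀)^m dH¹(z) be the interaction coefficients. Then for every real Q > 0 and every integer m ≥ 1, ∑_{k=1}^{∞} Q^k·|I_{m,k}| ≤ π·ρ·Q·(|z₀| + Q)^{m−1}. (The sum is in fact finite, since I_{m,k} = 0 for k > m.) -/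
open MeasureTheory Real Filter

noncomputable section

open scoped Classical

/-- Cauchy's formula for `(z - c) ^ n * z ^ (-(j + 1))` on a circle around `c` enclosing `0`. -/
lemma circleIntegral_sub_pow_mul_zpow {ρ : ℝ} {c : ℂ} (hc : ‖c‖ < ρ) (n j : ℕ) :
    (∮ z in C(c, ρ), z ^ (-((j + 1 : ℕ) : ℤ)) * (z - c) ^ n) =
      2 * π * Complex.I * ((n.choose j : ℂ) * (-c) ^ (n - j)) := by
  have hρ : 0 < ρ := (norm_nonneg c).trans_lt hc
  have hsph : (0 : ℂ) ∉ Metric.sphere c |ρ| := by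
    simp [abs_of_pos hρ, hc.ne]
  have hball : (0 : ℂ) ∈ Metric.ball c ρ := by simpa using hc
  have hexp : Set.EqOn (fun z : ℂ => z ^ (-((j + 1 : ℕ) : ℤ)) * (z - c) ^ n)
      (fun z => ∑ i ∈ Finset.range (n + 1),
        ((n.choose i : ℂ) * (-c) ^ (n - i)) * (z - 0) ^ ((i : ℤ) - (j + 1 : ℕ)))
      (Metric.sphere c ρ) := by
    intro z hz
    have hz0 : z ≠ 0 := by
      rintro rfl
      exact hsph (by rwa [abs_of_pos hρ])
    simp only [sub_zero]
    rw [sub_eq_add_neg z c, add_pow, Finset.mul_sum]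
    refine Finset.sum_congr rfl fun i _ => ?_
    rw [sub_eq_add_neg, zpow_add₀ hz0, zpow_natCast]
    ring
  rw [circleIntegral.integral_congr hρ.le hexp, circleIntegral.integral_fun_sum]
  · simp only [circleIntegral.integral_const_mul]
    rw [Finset.sum_eq_single j]
    · have : ((j : ℤ) - (j + 1 : ℕ)) = -1 := by push_cast; ring
      simp only [this, zpow_neg_one, circleIntegral.integral_sub_inv_of_mem_ball hball]
      ring
    · intro i _ hij
      rw [circleIntegral.integral_sub_zpow_of_ne (by push_cast; omega), mul_zero]
    · intro hj
      rw [Nat.choose_eq_zero_of_lt (by simpa using hj)]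
      simp
  · intro i _
    exact ((circleIntegrable_sub_zpow_iff).2 (Or.inr (Or.inr hsph))).const_smul

/-- The denominator of the holomorphic extension of `z ↦ conj z` off the circle of radius `ρ`
around `c` does not vanish on the closed disc. -/
lemma conj_mul_sub_add_sq_ne_zero {ρ : ℝ} {c z : ℂ} (hc : ‖c‖ < ρ)
    (hz : z ∈ Metric.closedBall c ρ) :
    (starRingEnd ℂ) c * (z - c) + (ρ : ℂ) ^ 2 ≠ 0 := by
  have hρ : 0 < ρ := (norm_nonneg c).trans_lt hc
  intro h
  have hn : ‖(starRingEnd ℂ) c * (z - c)‖ = ρ ^ 2 := by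
    rw [eq_neg_of_add_eq_zero_left h, norm_neg, norm_pow, Complex.norm_real, Real.norm_eq_abs,
      sq_abs]
  rw [norm_mul, RCLike.norm_conj] at hn
  rw [mem_closedBall_iff_norm] at hz
  nlinarith [norm_nonneg c, norm_nonneg (z - c)]

lemma differentiableOn_pow_div_conj_mul_sub_add_sq {ρ : ℝ} {c : ℂ} (hc : ‖c‖ < ρ) (p k : ℕ) :
    DifferentiableOn ℂ (fun z => (z - c) ^ p / ((starRingEnd ℂ) c * (z - c) + (ρ : ℂ) ^ 2) ^ k)
      (Metric.closedBall c ρ) := by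
  refine DifferentiableOn.div (by fun_prop) (by fun_prop) fun z hz => ?_
  exact pow_ne_zero _ (conj_mul_sub_add_sq_ne_zero hc hz)

/-- Closed form of the interaction coefficients; in particular they vanish for `j > n`. -/
lemma interactionCoeff_succ_succ {ρ : ℝ} {z₀ : ℂ} (hz₀ : ‖z₀‖ < ρ) (n j : ℕ) :
    interactionCoeff ρ z₀ (n + 1) (j + 1) =
      π * ρ * ((n.choose j : ℂ) * (-z₀) ^ (n - j)) := by
  have hρ : 0 < ρ := (norm_nonneg z₀).trans_lt hz₀
  have hρ' : (ρ : ℂ) ≠ 0 := by exact_mod_cast hρ.ne'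
  set f : ℂ → ℂ := fun z => z ^ (-((j + 1 : ℕ) : ℤ)) * (z - z₀) ^ n with hf
  set g : ℂ → ℂ := fun z =>
    (z - z₀) ^ (n + (j + 1)) / ((starRingEnd ℂ) z₀ * (z - z₀) + (ρ : ℂ) ^ 2) ^ (j + 1) with hg
  have hgd : DifferentiableOn ℂ g (Metric.closedBall z₀ ρ) :=
    differentiableOn_pow_div_conj_mul_sub_add_sq hz₀ _ _
  have hgi : CircleIntegrable g z₀ ρ :=
    (hgd.continuousOn.mono Metric.sphere_subset_closedBall).circleIntegrable hρ.le
  have hfi : CircleIntegrable f z₀ ρ := by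
    refine ContinuousOn.circleIntegrable hρ.le (ContinuousOn.mul ?_ (by fun_prop))
    refine continuousOn_id.zpow₀ _ fun z hz => Or.inl ?_
    rintro rfl
    simp [hz₀.ne] at hz
  have hg0 : (∮ z in C(z₀, ρ), g z) = 0 :=
    Complex.circleIntegral_eq_zero_of_differentiable_on_off_countable hρ.le
      Set.countable_empty hgd.continuousOn fun z hz =>
        hgd.differentiableAt (Metric.closedBall_mem_nhds_of_mem hz.1)
  have key : (∫ θ in (0:ℝ)..(2 * π),
      (((z₀ + (ρ : ℂ) * Complex.exp ((θ : ℂ) * Complex.I)) ^ (-((j + 1 : ℕ):ℤ))).re : ℂ) *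
        ((ρ : ℂ) * Complex.exp ((θ : ℂ) * Complex.I)) ^ (n + 1)) =
      (2 * Complex.I)⁻¹ * ∮ z in C(z₀, ρ), (f z + g z) := by
    rw [circleIntegral, ← intervalIntegral.integral_const_mul]
    refine intervalIntegral.integral_congr fun θ _ => ?_
    have hmem : circleMap z₀ ρ θ ∈ Metric.closedBall z₀ ρ :=
      circleMap_mem_closedBall _ hρ.le _
    have hden := conj_mul_sub_add_sq_ne_zero hz₀ hmem
    simp only [deriv_circleMap, smul_eq_mul, hf, hg]
    simp only [circleMap, zero_add, add_sub_cancel_left] at hden ⊢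
    set w : ℂ := (ρ : ℂ) * Complex.exp ((θ : ℂ) * Complex.I) with hw
    have hw0 : w ≠ 0 := mul_ne_zero hρ' (Complex.exp_ne_zero _)
    have hnorm : ‖w‖ = ρ := by
      rw [hw, norm_mul, Complex.norm_exp_ofReal_mul_I, mul_one, Complex.norm_real,
        Real.norm_eq_abs, abs_of_pos hρ]
    have hww : (starRingEnd ℂ) w = (ρ : ℂ) ^ 2 / w := by
      rw [eq_div_iff hw0, mul_comm, Complex.mul_conj, Complex.normSq_eq_norm_sq, hnorm]
      push_cast; rfl
    have hconj : (starRingEnd ℂ) (z₀ + w) =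
        ((starRingEnd ℂ) z₀ * w + (ρ : ℂ) ^ 2) / w := by
      rw [map_add, hww]; field_simp
    rw [Complex.re_eq_add_conj, map_zpow₀, hconj, zpow_neg, zpow_natCast, zpow_neg, zpow_natCast,
      div_pow, inv_div, mul_inv]
    have hI : Complex.I⁻¹ * Complex.I = 1 := inv_mul_cancel₀ Complex.I_ne_zero
    rw [show ∀ A : ℂ, 2⁻¹ * Complex.I⁻¹ * (w * Complex.I * A) =
      (Complex.I⁻¹ * Complex.I) * (w * A / 2) from fun A => by ring, hI]
    ring
  rw [interactionCoeff, key, circleIntegral.integral_add hfi hgi, hg0,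
    circleIntegral_sub_pow_mul_zpow hz₀]
  field_simp
  ring

/-- summed estimate for the interaction coefficients: for every `Q > 0` and
`m ≥ 1`, `∑_{k ≥ 1} Q^k |I_{m,k}| ≤ π ρ Q (|z₀| + Q)^{m-1}` (the sum over `k = j + 1`,
`j : ℕ`; it is in fact a finite sum since `I_{m,k} = 0` for `k > m`). -/
theorem interactionCoeff_summed_estimate
    (ρ : ℝ) (hρ : 0 < ρ) (z₀ : ℂ) (hz₀ : ‖z₀‖ < ρ)
    (Q : ℝ) (hQ : 0 < Q) (m : ℕ) (hm : 1 ≤ m) :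
    Summable (fun j : ℕ => Q ^ (j + 1) * ‖interactionCoeff ρ z₀ m (j + 1)‖) ∧
    (∑' j : ℕ, Q ^ (j + 1) * ‖interactionCoeff ρ z₀ m (j + 1)‖) ≤
      π * ρ * Q * (‖z₀‖ + Q) ^ (m - 1) := by
  obtain ⟨n, rfl⟩ := Nat.exists_eq_add_of_le' hm
  have hterm : ∀ j : ℕ, Q ^ (j + 1) * ‖interactionCoeff ρ z₀ (n + 1) (j + 1)‖ =
      π * ρ * Q * (Q ^ j * ‖z₀‖ ^ (n - j) * (n.choose j : ℝ)) := by
    intro j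
    rw [interactionCoeff_succ_succ hz₀]
    simp only [norm_mul, norm_pow, norm_neg, Complex.norm_real, Complex.norm_natCast,
      Real.norm_eq_abs, abs_of_pos hρ, abs_of_pos pi_pos]
    ring
  have hsum : HasSum (fun j : ℕ => Q ^ (j + 1) * ‖interactionCoeff ρ z₀ (n + 1) (j + 1)‖)
      (π * ρ * Q * (‖z₀‖ + Q) ^ n) := by
    simp only [hterm]
    rw [add_comm ‖z₀‖ Q, add_pow]
    refine HasSum.mul_left _ (hasSum_sum_of_ne_finset_zero fun j hj => ?_)
    rw [Nat.choose_eq_zero_of_lt (by simpa using hj)]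
    simp
  exact ⟨hsum.summable, hsum.tsum_eq.le⟩
end
end
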